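/- Let t = t(n) be a sequence of nonnegative integers satisfying liminf_{n→∞} t/(n² ln n) ≥ 4/π². Then h_n(x,t) = (1 + O(n^{−2})) · (4/π) cos^t(π/n) sin(πx/n), uniformly in x: there exist a constant C > 0 and n₀ such that for all n ≥ n₀ and all integers x with 1 ≤ x ≤ n−1, | h_n(x,t) / ( (4/π) cos^t(π/n) sin(πx/n) ) − 1 | ≤ C n^{−2}. -/

import Mathlib

open MeasureTheory ProbabilityTheory Finset Filter
open scoped ENNReal Topology

/-- One step transition probability of the simple random walk on `ℤ`. -/
noncomputable def srwStep (u v : ℤ) : ℝ≥0∞ :=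
  if v = u + 1 ∨ v = u - 1 then (1 : ℝ≥0∞) / 2 else 0

/-- `P x` is the law of the simple random walk `S` on `ℤ` started at `x`:
for every finite path `γ` with `γ 0 = x`, the probability of following `γ`
during the first `t` steps is the product of the one-step transition
probabilities. -/
def IsSRW {Ω : Type*} [MeasurableSpace Ω] (P : ℤ → Measure Ω) (S : ℕ → Ω → ℤ) : Prop :=
  (∀ x, IsProbabilityMeasure (P x)) ∧ (∀ t, Measurable (S t)) ∧
    ∀ (x : ℤ) (t : ℕ) (γ : ℕ → ℤ), γ 0 = x →
      P x {ω | ∀ s ≤ t, S s ω = γ s} = ∏ s ∈ Finset.range t, srwStep (γ s) (γ (s + 1))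

/-- The probability that the simple random walk started at `x` avoids `A` up to time `t`,
defined by first-step analysis. -/
noncomputable def srwAvoid (A : Set ℤ) [DecidablePred (· ∈ A)] : ℕ → ℤ → ℝ≥0∞
  | 0, x => if x ∈ A then 0 else 1
  | t + 1, x => if x ∈ A then 0 else (srwAvoid A t (x + 1) + srwAvoid A t (x - 1)) / 2

theorem tsum_srwStep_mul (u : ℤ) (f : ℤ → ℝ≥0∞) :
    ∑' v, srwStep u v * f v = (f (u + 1) + f (u - 1)) / 2 := by
  rw [tsum_eq_sum (s := {u + 1, u - 1})]
  · rw [Finset.sum_pair (by omega)]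
    simp only [srwStep, true_or, or_true, if_true]
    rw [← mul_add, mul_comm, ENNReal.div_eq_inv_mul, ENNReal.div_eq_inv_mul, mul_one, mul_comm]
  · intro v hv
    simp only [Finset.mem_insert, Finset.mem_singleton] at hv
    simp [srwStep, hv]

theorem IsSRW.measure_cylinder_avoid {Ω : Type*} [MeasurableSpace Ω] {P : ℤ → Measure Ω}
    {S : ℕ → Ω → ℤ} (hS : IsSRW P S) (A : Set ℤ) [DecidablePred (· ∈ A)] (m : ℕ) :
    ∀ (k : ℕ) (γ : ℕ → ℤ),
      P (γ 0) {ω | (∀ s ≤ k, S s ω = γ s) ∧ ∀ s, k ≤ s → s ≤ k + m → S s ω ∉ A} =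
        (∏ s ∈ Finset.range k, srwStep (γ s) (γ (s + 1))) * srwAvoid A m (γ k) := by
  induction m with
  | zero =>
    intro k γ
    by_cases hA : γ k ∈ A
    · have : {ω | (∀ s ≤ k, S s ω = γ s) ∧ ∀ s, k ≤ s → s ≤ k + 0 → S s ω ∉ A} = ∅ := by
        ext ω
        simp only [Set.mem_ofPred_eq, Set.mem_empty_iff_false, iff_false]
        rintro ⟨h, h'⟩
        exact h' k le_rfl (by omega) (by rwa [h k le_rfl])
      rw [this, measure_empty]
      simp [srwAvoid, hA]
    · have : {ω | (∀ s ≤ k, S s ω = γ s) ∧ ∀ s, k ≤ s → s ≤ k + 0 → S s ω ∉ A} =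
          {ω | ∀ s ≤ k, S s ω = γ s} := by
        ext ω
        simp only [Set.mem_ofPred_eq, and_iff_left_iff_imp]
        intro h s hs hs'
        obtain rfl : s = k := by omega
        rwa [h s le_rfl]
      rw [this, hS.2.2 _ k γ rfl]
      simp [srwAvoid, hA]
  | succ m ih =>
    intro k γ
    by_cases hA : γ k ∈ A
    · have : {ω | (∀ s ≤ k, S s ω = γ s) ∧ ∀ s, k ≤ s → s ≤ k + (m + 1) → S s ω ∉ A} = ∅ := by
        ext ω
        simp only [Set.mem_ofPred_eq, Set.mem_empty_iff_false, iff_false]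
        rintro ⟨h, h'⟩
        exact h' k le_rfl (by omega) (by rwa [h k le_rfl])
      simp [this, srwAvoid, hA]
    · have hupd : ∀ v, ∀ s ≤ k, Function.update γ (k + 1) v s = γ s := fun v s hs =>
        Function.update_of_ne (by omega) _ _
      have hunion : {ω | (∀ s ≤ k, S s ω = γ s) ∧ ∀ s, k ≤ s → s ≤ k + (m + 1) → S s ω ∉ A} =
          ⋃ v : ℤ, {ω | (∀ s ≤ k + 1, S s ω = Function.update γ (k + 1) v s) ∧
            ∀ s, k + 1 ≤ s → s ≤ k + 1 + m → S s ω ∉ A} := by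
        ext ω
        simp only [Set.mem_ofPred_eq, Set.mem_iUnion]
        constructor
        · rintro ⟨h, h'⟩
          refine ⟨S (k + 1) ω, fun s hs => ?_, fun s hs hs' => h' s (by omega) (by omega)⟩
          rcases hs.lt_or_eq with hs | rfl
          · rw [hupd _ s (by omega), h s (by omega)]
          · simp
        · rintro ⟨v, h, h'⟩
          have hγ : ∀ s ≤ k, S s ω = γ s := fun s hs => by rw [h s (by omega), hupd v s hs]
          refine ⟨hγ, fun s hs hs' => ?_⟩
          rcases hs.lt_or_eq with hs | rfl
          · exact h' s (by omega) (by omega)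
          · rwa [hγ k le_rfl]
      rw [hunion, measure_iUnion]
      · have hterm : ∀ v : ℤ,
            P (γ 0) {ω | (∀ s ≤ k + 1, S s ω = Function.update γ (k + 1) v s) ∧
              ∀ s, k + 1 ≤ s → s ≤ k + 1 + m → S s ω ∉ A} =
            (∏ s ∈ Finset.range k, srwStep (γ s) (γ (s + 1))) *
              (srwStep (γ k) v * srwAvoid A m v) := by
          intro v
          have := ih (k + 1) (Function.update γ (k + 1) v)
          rw [hupd v 0 (by omega)] at this
          rw [this, Finset.prod_range_succ, hupd v k le_rfl, Function.update_self, mul_assoc]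
          congr 1
          refine Finset.prod_congr rfl fun s hs => ?_
          rw [Finset.mem_range] at hs
          rw [hupd v s (by omega), hupd v (s + 1) (by omega)]
        simp_rw [hterm]
        rw [ENNReal.tsum_mul_left, tsum_srwStep_mul]
        simp [srwAvoid, hA]
      · intro v w hvw
        refine Set.disjoint_left.2 fun ω hv hw => hvw ?_
        have h₁ := hv.1 (k + 1) le_rfl
        have h₂ := hw.1 (k + 1) le_rfl
        rw [Function.update_self] at h₁ h₂
        exact h₁.symm.trans h₂
      · intro v
        have hmeas := hS.2.1
        have h₁ : ∀ s (B : Set ℤ), MeasurableSet {ω | S s ω ∈ B} := fun s B =>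
          hmeas s (MeasurableSet.of_discrete (s := B))
        have h₂ : MeasurableSet {ω | ∀ s ≤ k + 1, S s ω = Function.update γ (k + 1) v s} := by
          simp only [Set.ofPred_forall]
          exact MeasurableSet.iInter fun s => MeasurableSet.iInter fun _ => h₁ s {_}
        have h₃ : MeasurableSet {ω | ∀ s, k + 1 ≤ s → s ≤ k + 1 + m → S s ω ∉ A} := by
          simp only [Set.ofPred_forall]
          exact MeasurableSet.iInter fun s => MeasurableSet.iInter fun _ =>
            MeasurableSet.iInter fun _ => h₁ s Aᶜ
        exact h₂.inter h₃

theorem IsSRW.measure_avoid {Ω : Type*} [MeasurableSpace Ω] {P : ℤ → Measure Ω}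
    {S : ℕ → Ω → ℤ} (hS : IsSRW P S) (A : Set ℤ) [DecidablePred (· ∈ A)] (x : ℤ) (t : ℕ) :
    P x {ω | ∀ s ≤ t, S s ω ∉ A} = srwAvoid A t x := by
  have := hS.1 x
  have hstart : ∀ᵐ ω ∂P x, S 0 ω = x := by
    have h := hS.2.2 x 0 (fun _ => x) rfl
    simp only [Nat.le_zero, forall_eq, Finset.range_zero, Finset.prod_empty] at h
    exact (prob_compl_eq_zero_iff (hS.2.1 0 (MeasurableSet.of_discrete (s := {x})))).2 h
  have h := hS.measure_cylinder_avoid A t 0 (fun _ => x)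
  simp only [Nat.le_zero, forall_eq, Finset.range_zero, Finset.prod_empty, one_mul, zero_add,
    Nat.zero_le, true_imp_iff] at h
  rw [← h]
  refine measure_congr ?_
  filter_upwards [hstart] with ω hω
  exact propext ⟨fun h => ⟨hω, h⟩, fun h => h.2⟩

/-- The eigenfunction expansion of the probability that the simple random walk started at `x`
stays in `(0, n)` up to time `t`. -/
noncomputable def srwSpectral (n t : ℕ) (x : ℝ) : ℝ :=
  ∑ j ∈ Finset.range n, Real.cot ((2 * j + 1) * (Real.pi / (2 * n))) / n *
    Real.cos ((2 * j + 1) * (Real.pi / n)) ^ t * Real.sin ((2 * j + 1) * (Real.pi * x / n))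

theorem sin_mul_sum_cos_odd (n : ℕ) (φ : ℝ) :
    2 * Real.sin φ * ∑ j ∈ Finset.range n, Real.cos ((2 * j + 1) * φ) = Real.sin (2 * n * φ) := by
  induction n with
  | zero => simp
  | succ n ih =>
    rw [Finset.sum_range_succ, mul_add, ih]
    push_cast
    have h₁ : 2 * (n + 1 : ℝ) * φ = (2 * n + 1) * φ + φ := by ring
    have h₂ : 2 * (n : ℝ) * φ = (2 * n + 1) * φ - φ := by ring
    rw [h₁, h₂, Real.sin_add, Real.sin_sub]
    ring

theorem srwSpectral_zero_right (n t : ℕ) : srwSpectral n t 0 = 0 := by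
  simp [srwSpectral]

theorem srwSpectral_self (n t : ℕ) (hn : n ≠ 0) : srwSpectral n t n = 0 := by
  refine Finset.sum_eq_zero fun j _ => ?_
  have : (2 * (j : ℝ) + 1) * (Real.pi * n / n) = ((2 * j + 1 : ℕ) : ℝ) * Real.pi := by
    push_cast
    field_simp
  rw [this, Real.sin_nat_mul_pi, mul_zero]

theorem srwSpectral_succ (n t : ℕ) (x : ℝ) :
    srwSpectral n (t + 1) x = (srwSpectral n t (x + 1) + srwSpectral n t (x - 1)) / 2 := by
  simp only [srwSpectral]
  rw [← Finset.sum_add_distrib, Finset.sum_div]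
  refine Finset.sum_congr rfl fun j _ => ?_
  have h₁ : (2 * (j : ℝ) + 1) * (Real.pi * (x + 1) / n) =
      (2 * j + 1) * (Real.pi * x / n) + (2 * j + 1) * (Real.pi / n) := by ring
  have h₂ : (2 * (j : ℝ) + 1) * (Real.pi * (x - 1) / n) =
      (2 * j + 1) * (Real.pi * x / n) - (2 * j + 1) * (Real.pi / n) := by ring
  rw [h₁, h₂, Real.sin_add, Real.sin_sub]
  ring

theorem sum_cos_odd_eq_zero {n y : ℕ} (hy : 0 < y) (hyn : y < n) :
    ∑ j ∈ Finset.range n, Real.cos ((2 * j + 1) * (Real.pi * y / n)) = 0 := by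
  have hn : (0 : ℝ) < n := by exact_mod_cast hy.trans hyn
  have hy' : (0 : ℝ) < y := by exact_mod_cast hy
  have hyn' : (y : ℝ) < n := by exact_mod_cast hyn
  have hsin : 0 < Real.sin (Real.pi * y / n) := by
    refine Real.sin_pos_of_pos_of_lt_pi (by positivity) ?_
    rw [div_lt_iff₀ hn]
    exact mul_lt_mul_of_pos_left hyn' Real.pi_pos
  have h := sin_mul_sum_cos_odd n (Real.pi * y / n)
  have h' : 2 * (n : ℝ) * (Real.pi * y / n) = ((2 * y : ℕ) : ℝ) * Real.pi := by
    push_cast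
    field_simp
  rw [h', Real.sin_nat_mul_pi] at h
  exact (mul_eq_zero.1 h).resolve_left (by positivity)

theorem sin_odd_mul_pi_div_pos {n j : ℕ} (hj : j < n) :
    0 < Real.sin ((2 * j + 1) * (Real.pi / (2 * n))) := by
  have hn : (0 : ℝ) < n := by exact_mod_cast j.zero_le.trans_lt hj
  have hj' : (j : ℝ) + 1 ≤ n := by exact_mod_cast hj
  refine Real.sin_pos_of_pos_of_lt_pi (by positivity) ?_
  rw [← mul_div_assoc, div_lt_iff₀ (by positivity)]
  nlinarith [Real.pi_pos]

theorem srwSpectral_zero_succ_sub (n : ℕ) (x : ℝ) :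
    srwSpectral n 0 (x + 1) - srwSpectral n 0 x =
      (∑ j ∈ Finset.range n, Real.cos ((2 * j + 1) * (Real.pi * (x + 1) / n)) +
        ∑ j ∈ Finset.range n, Real.cos ((2 * j + 1) * (Real.pi * x / n))) / n := by
  simp only [srwSpectral]
  rw [← Finset.sum_add_distrib, ← Finset.sum_sub_distrib, Finset.sum_div]
  refine Finset.sum_congr rfl fun j hj => ?_
  have hs := (sin_odd_mul_pi_div_pos (Finset.mem_range.1 hj)).ne'
  rw [Real.cot_eq_cos_div_sin]
  set a := (2 * (j : ℝ) + 1) * (Real.pi / (2 * n))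
  set b := (2 * (j : ℝ) + 1) * (Real.pi * x / n)
  have h₁ : (2 * (j : ℝ) + 1) * (Real.pi * (x + 1) / n) = b + 2 * a := by
    simp only [a, b]
    ring
  have key : Real.cos a * (Real.sin (b + 2 * a) - Real.sin b) =
      Real.sin a * (Real.cos (b + 2 * a) + Real.cos b) := by
    rw [Real.sin_add, Real.cos_add, Real.sin_two_mul, Real.cos_two_mul']
    linear_combination (Real.cos a * Real.sin b + Real.sin a * Real.cos b) *
      Real.sin_sq_add_cos_sq a
  rw [h₁, pow_zero, mul_one, ← mul_sub]
  field_simp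
  linear_combination key / n

theorem srwSpectral_zero_left {n x : ℕ} (hx : 0 < x) (hxn : x < n) :
    srwSpectral n 0 x = 1 := by
  have hn : (n : ℝ) ≠ 0 := by exact_mod_cast (hx.trans hxn).ne'
  induction x, Nat.succ_le_of_lt hx using Nat.le_induction with
  | base =>
    have h := srwSpectral_zero_succ_sub n 0
    have h₁ := sum_cos_odd_eq_zero one_pos hxn
    rw [zero_add, srwSpectral_zero_right] at h
    rw [Nat.cast_one] at h₁
    rw [h₁] at h
    simpa [hn] using h
  | succ x hx' ih =>
    have h := srwSpectral_zero_succ_sub n x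
    have h₁ := sum_cos_odd_eq_zero hx hxn
    have h₂ := sum_cos_odd_eq_zero (n := n) (y := x) hx' (by omega)
    push_cast at h₁ ⊢
    rw [h₁, h₂, ih hx' (by omega)] at h
    simpa [sub_eq_zero] using h

theorem srwAvoid_eq_ofReal_srwSpectral {n : ℕ} (hn : n ≠ 0)
    [DecidablePred (· ∈ ({0, (n : ℤ)} : Set ℤ))] (t : ℕ) : ∀ x : ℕ, x ≤ n → 0 ≤ srwSpectral n t x ∧
      srwAvoid {0, (n : ℤ)} t x = ENNReal.ofReal (srwSpectral n t x) := by
  have hbdry : ∀ (t x : ℕ), x = 0 ∨ x = n → 0 ≤ srwSpectral n t x ∧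
      srwAvoid {0, (n : ℤ)} t x = ENNReal.ofReal (srwSpectral n t x) := by
    rintro t x hx
    have hF : srwSpectral n t x = 0 := by
      rcases hx with rfl | rfl
      · simpa using srwSpectral_zero_right n t
      · exact srwSpectral_self x t hn
    rw [hF]
    cases t <;> simp [srwAvoid, hx]
  induction t with
  | zero =>
    intro x hxn
    by_cases hx : x = 0 ∨ x = n
    · exact hbdry 0 x hx
    · rw [srwSpectral_zero_left (n := n) (x := x) (by omega) (by omega)]
      simp [srwAvoid, hx]
  | succ t ih =>
    intro x hxn
    by_cases hx : x = 0 ∨ x = n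
    · exact hbdry (t + 1) x hx
    · obtain ⟨y, rfl⟩ : ∃ y, x = y + 1 := ⟨x - 1, by omega⟩
      obtain ⟨h₁, h₁'⟩ := ih y (by omega)
      obtain ⟨h₂, h₂'⟩ := ih (y + 2) (by omega)
      have hF := srwSpectral_succ n t (y + 1)
      have e₁ : (y : ℝ) + 1 + 1 = (y + 2 : ℕ) := by push_cast; ring
      have e₂ : (y : ℝ) + 1 - 1 = y := by ring
      have e₃ : ((y + 1 : ℕ) : ℤ) + 1 = (y + 2 : ℕ) := by push_cast; ring
      have e₄ : ((y + 1 : ℕ) : ℤ) - 1 = y := by push_cast; ring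
      rw [e₁, e₂] at hF
      have hmem : ((y + 1 : ℕ) : ℤ) ∉ ({0, (n : ℤ)} : Set ℤ) := by
        simp only [Set.mem_insert_iff, Set.mem_singleton_iff]
        omega
      rw [srwAvoid, if_neg hmem, e₃, e₄, h₁', h₂', ← ENNReal.ofReal_add h₂ h₁, Nat.cast_succ, hF]
      refine ⟨by positivity, ?_⟩
      rw [ENNReal.ofReal_div_of_pos two_pos, ENNReal.ofReal_ofNat]

theorem abs_sin_nat_mul_le (k : ℕ) (θ : ℝ) : |Real.sin (k * θ)| ≤ k * |Real.sin θ| := by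
  induction k with
  | zero => simp
  | succ k ih =>
    push_cast
    rw [add_mul, one_mul, Real.sin_add, add_mul, one_mul]
    refine (abs_add_le _ _).trans (add_le_add ?_ ?_)
    · rw [abs_mul]
      exact (mul_le_of_le_one_right (abs_nonneg _) (Real.abs_cos_le_one _)).trans ih
    · rw [abs_mul]
      exact mul_le_of_le_one_left (abs_nonneg _) (Real.abs_cos_le_one _)

theorem abs_cos_le_cos_of_mem_Icc {a b : ℝ} (hb : 0 ≤ b) (hba : b ≤ a) (ha : a ≤ Real.pi - b) :
    |Real.cos a| ≤ Real.cos b := by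
  rw [abs_le]
  constructor
  · rw [← Real.cos_pi_sub]
    exact Real.cos_le_cos_of_nonneg_of_le_pi (by linarith) (by linarith) ha
  · exact Real.cos_le_cos_of_nonneg_of_le_pi hb (by linarith) hba

theorem cos_two_mul_le_cos_mul_exp {θ : ℝ} (h : |2 * θ| ≤ 1) :
    Real.cos (2 * θ) ≤ Real.cos θ * Real.exp (-(4 / 3) * θ ^ 2) := by
  have h₁ := (abs_le.1 (Real.cos_bound h)).2
  have h₂ := Real.one_sub_sq_div_two_le_cos (x := θ)
  have h₃ : 1 - 4 / 3 * θ ^ 2 ≤ Real.exp (-(4 / 3) * θ ^ 2) := by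
    have := Real.add_one_le_exp (-(4 / 3) * θ ^ 2)
    linarith
  have hθ : θ ^ 2 ≤ 1 / 4 := by
    have := sq_le_one_iff_abs_le_one (2 * θ) |>.2 h
    nlinarith
  have h₄ : |2 * θ| ^ 4 = 16 * (θ ^ 2) ^ 2 := by
    rw [show |2 * θ| ^ 4 = (|2 * θ| ^ 2) ^ 2 by ring, sq_abs]
    ring
  rw [h₄] at h₁
  calc Real.cos (2 * θ) ≤ (1 - θ ^ 2 / 2) * (1 - 4 / 3 * θ ^ 2) := by nlinarith [sq_nonneg θ]
    _ ≤ Real.cos θ * Real.exp (-(4 / 3) * θ ^ 2) :=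
      mul_le_mul h₂ h₃ (by nlinarith) (by nlinarith)

theorem abs_mul_cot_sub_one_le {φ : ℝ} (h₀ : 0 < φ) (h₁ : φ < Real.pi / 2) :
    |φ * Real.cot φ - 1| ≤ φ ^ 2 / 2 := by
  have hs : 0 < Real.sin φ := Real.sin_pos_of_pos_of_lt_pi h₀ (by linarith)
  have hc : 0 < Real.cos φ := Real.cos_pos_of_mem_Ioo ⟨by linarith, h₁⟩
  have htan := Real.lt_tan h₀ h₁
  rw [Real.tan_eq_sin_div_cos, lt_div_iff₀ hc] at htan
  have hcos := Real.one_sub_sq_div_two_le_cos (x := φ)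
  have hlow : Real.cos φ ≤ φ * Real.cot φ := by
    rw [Real.cot_eq_cos_div_sin, ← mul_div_assoc, le_div_iff₀ hs, mul_comm]
    exact mul_le_mul_of_nonneg_right (Real.sin_lt h₀).le hc.le
  have hup : φ * Real.cot φ ≤ 1 := by
    rw [Real.cot_eq_cos_div_sin, ← mul_div_assoc, div_le_one hs]
    exact htan.le
  rw [abs_le]
  constructor <;> nlinarith [sq_nonneg φ]

theorem abs_cot_odd_mul_le {n j : ℕ} (hj : j < n) :
    |Real.cot ((2 * j + 1) * (Real.pi / (2 * n)))| ≤ n := by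
  have hn : (0 : ℝ) < n := by exact_mod_cast j.zero_le.trans_lt hj
  have hj' : (j : ℝ) + 1 ≤ n := by exact_mod_cast hj
  set φ := Real.pi / (2 * n) with hφ
  have hφ0 : 0 < φ := by positivity
  have hφn : 2 * n * φ = Real.pi := by rw [hφ]; field_simp
  have hn1 : (1 : ℝ) ≤ n := by linarith [(Nat.cast_nonneg j : (0 : ℝ) ≤ j)]
  have hsin : 1 / (n : ℝ) ≤ Real.sin φ := by
    have := Real.mul_le_sin hφ0.le (by nlinarith)
    calc 1 / (n : ℝ) = 2 / Real.pi * φ := by rw [hφ]; field_simp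
      _ ≤ _ := this
  have hcos : |Real.cos ((2 * j + 1) * φ - Real.pi / 2)| =
      Real.sin ((2 * j + 1) * φ) := by
    rw [Real.cos_sub_pi_div_two, abs_of_pos (sin_odd_mul_pi_div_pos hj)]
  have hle : Real.sin φ ≤ Real.sin ((2 * j + 1) * φ) := by
    rw [← hcos, ← Real.cos_pi_div_two_sub, ← Real.cos_abs ((2 * j + 1) * φ - Real.pi / 2)]
    refine le_trans ?_ (le_abs_self _)
    refine Real.cos_le_cos_of_nonneg_of_le_pi (abs_nonneg _) (by linarith [Real.pi_pos]) ?_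
    rw [abs_le]
    have := mul_nonneg (Nat.cast_nonneg j : (0 : ℝ) ≤ j) hφ0.le
    constructor <;> nlinarith
  have hpos := sin_odd_mul_pi_div_pos hj
  rw [Real.cot_eq_cos_div_sin, abs_div, abs_of_pos hpos, div_le_iff₀ hpos]
  refine (Real.abs_cos_le_one _).trans ?_
  rw [div_le_iff₀ hn] at hsin
  nlinarith

/-- In the spectral sum, the terms whose frequency is not within one of `0`, `n` or `2 * n`
decay at least like the second eigenvalue. -/
theorem abs_cos_odd_mul_le {n j : ℕ} (h₁ : 0 < j) (h₂ : j + 1 < n)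
    (h : 2 * j + 1 + 2 ≤ n ∨ n + 2 ≤ 2 * j + 1) :
    |Real.cos ((2 * j + 1) * (Real.pi / n))| ≤ Real.cos (2 * (Real.pi / n)) := by
  have hn : (0 : ℝ) < n := by exact_mod_cast (by omega : 0 < n)
  have hθ : 0 < Real.pi / n := by positivity
  have hnθ : n * (Real.pi / n) = Real.pi := by field_simp
  set θ := Real.pi / n
  have h₁' : (1 : ℝ) ≤ j := by exact_mod_cast h₁
  have h₂' : (j : ℝ) + 2 ≤ n := by exact_mod_cast h₂
  rcases h with h | h
  · have h' : 2 * (j : ℝ) + 1 + 2 ≤ n := by exact_mod_cast h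
    exact abs_cos_le_cos_of_mem_Icc (by positivity) (by nlinarith) (by nlinarith)
  · have h' : (n : ℝ) + 2 ≤ 2 * j + 1 := by exact_mod_cast h
    rw [← abs_neg, ← Real.cos_sub_pi]
    exact abs_cos_le_cos_of_mem_Icc (by positivity) (by nlinarith) (by nlinarith)

theorem abs_srwSpectral_far_term_le {n j x : ℕ} (t : ℕ) (h₁ : 0 < j) (h₂ : j + 1 < n)
    (h : 2 * j + 1 + 2 ≤ n ∨ n + 2 ≤ 2 * j + 1) :
    |Real.cot ((2 * j + 1) * (Real.pi / (2 * n))) / n *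
      Real.cos ((2 * j + 1) * (Real.pi / n)) ^ t * Real.sin ((2 * j + 1) * (Real.pi * x / n))| ≤
    2 * n * Real.cos (2 * (Real.pi / n)) ^ t * |Real.sin (Real.pi * x / n)| := by
  have hn : (0 : ℝ) < n := by exact_mod_cast (by omega : 0 < n)
  have hcos := abs_cos_odd_mul_le h₁ h₂ h
  have hcos0 : 0 ≤ Real.cos (2 * (Real.pi / n)) := (abs_nonneg _).trans hcos
  have hsin := abs_sin_nat_mul_le (2 * j + 1) (Real.pi * x / n)
  push_cast at hsin
  have hk : 2 * (j : ℝ) + 1 ≤ 2 * n := by exact_mod_cast (by omega : 2 * j + 1 ≤ 2 * n)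
  have hcot : |Real.cot ((2 * j + 1) * (Real.pi / (2 * n))) / n| ≤ 1 := by
    rw [abs_div, abs_of_pos hn, div_le_one hn]
    exact abs_cot_odd_mul_le (by omega)
  rw [abs_mul, abs_mul, abs_pow]
  calc _ ≤ 1 * Real.cos (2 * (Real.pi / n)) ^ t * (2 * n * |Real.sin (Real.pi * x / n)|) := by
        gcongr
        exact hsin.trans (by gcongr)
    _ = _ := by ring

theorem abs_srwSpectral_middle_term_le {n j x : ℕ} (t : ℕ) (hn : 2 ≤ n) (h₁ : n ≤ 2 * j + 2)
    (h₂ : 2 * j ≤ n) :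
    |Real.cot ((2 * j + 1) * (Real.pi / (2 * n))) / n *
      Real.cos ((2 * j + 1) * (Real.pi / n)) ^ t * Real.sin ((2 * j + 1) * (Real.pi * x / n))| ≤
    4 / n ^ 2 * Real.cos (Real.pi / n) ^ t * |Real.sin (Real.pi * x / n)| := by
  have hn' : (2 : ℝ) ≤ n := by exact_mod_cast hn
  have hn0 : (0 : ℝ) < n := by linarith
  have hcos0 : 0 ≤ Real.cos (Real.pi / n) := by
    refine Real.cos_nonneg_of_neg_pi_div_two_le_of_le ?_ ?_
    · have : 0 < Real.pi / n := by positivity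
      linarith [Real.pi_pos]
    · gcongr
  have hcosx : |Real.cos (x * Real.pi)| = 1 := by exact_mod_cast Real.abs_cos_int_mul_pi x
  obtain hk | hk | hk : 2 * j + 1 = n ∨ 2 * j + 2 = n ∨ 2 * j = n := by omega
  · have hk' : 2 * (j : ℝ) + 1 = n := by exact_mod_cast hk
    have : (n : ℝ) * (Real.pi / (2 * n)) = Real.pi / 2 := by field_simp
    rw [hk', this, Real.cot_eq_cos_div_sin, Real.cos_pi_div_two]
    simp only [zero_div, zero_mul, abs_zero]
    positivity
  all_goals
    have hφ : Real.pi / (2 * n) ≤ Real.pi / 4 := by gcongr; linarith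
    have hφ0 : 0 < Real.pi / (2 * n) := by positivity
    have hsin : Real.sin (Real.pi / (2 * n)) ≤ Real.pi / (2 * n) := Real.sin_le hφ0.le
    have hsin0 : 0 ≤ Real.sin (Real.pi / (2 * n)) :=
      Real.sin_nonneg_of_nonneg_of_le_pi hφ0.le (by linarith [Real.pi_pos])
    have hcos : 1 / 2 ≤ Real.cos (Real.pi / (2 * n)) := by
      rw [← Real.cos_pi_div_three]
      exact Real.cos_le_cos_of_nonneg_of_le_pi hφ0.le (by linarith [Real.pi_pos])
        (by linarith [Real.pi_pos])
    have hcot : Real.sin (Real.pi / (2 * n)) / Real.cos (Real.pi / (2 * n)) / n ≤ 4 / n ^ 2 := by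
      rw [div_div, div_le_div_iff₀ (by positivity) (by positivity)]
      have : Real.sin (Real.pi / (2 * n)) * n ≤ 2 := by
        have := mul_le_mul_of_nonneg_right hsin hn0.le
        have h' : Real.pi / (2 * n) * n = Real.pi / 2 := by field_simp
        linarith [Real.pi_le_four]
      nlinarith
  · have hk' : 2 * (j : ℝ) + 2 = n := by exact_mod_cast hk
    have e₁ : (2 * (j : ℝ) + 1) * (Real.pi / (2 * n)) = Real.pi / 2 - Real.pi / (2 * n) := by
      field_simp
      linarith
    have e₂ : (2 * (j : ℝ) + 1) * (Real.pi / n) = Real.pi - Real.pi / n := by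
      field_simp
      linarith
    have e₃ : (2 * (j : ℝ) + 1) * (Real.pi * x / n) = x * Real.pi - Real.pi * x / n := by
      rw [show 2 * (j : ℝ) + 1 = n - 1 by linarith]
      field_simp
    rw [e₁, e₂, e₃, Real.cot_eq_cos_div_sin, Real.cos_pi_div_two_sub, Real.sin_pi_div_two_sub,
      Real.cos_pi_sub, Real.sin_sub, Real.sin_nat_mul_pi, abs_mul, abs_mul, abs_pow, abs_neg,
      abs_of_nonneg hcos0, abs_of_nonneg (by positivity), zero_mul, zero_sub, abs_neg, abs_mul,
      hcosx, one_mul]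
    gcongr
  · have hk' : 2 * (j : ℝ) = n := by exact_mod_cast hk
    have e₁ : (2 * (j : ℝ) + 1) * (Real.pi / (2 * n)) = Real.pi / (2 * n) + Real.pi / 2 := by
      rw [hk']
      field_simp
      ring
    have e₂ : (2 * (j : ℝ) + 1) * (Real.pi / n) = Real.pi / n + Real.pi := by
      rw [hk']
      field_simp
      ring
    have e₃ : (2 * (j : ℝ) + 1) * (Real.pi * x / n) = Real.pi * x / n + x * Real.pi := by
      rw [hk']
      field_simp
      ring
    rw [e₁, e₂, e₃, Real.cot_eq_cos_div_sin, Real.cos_add_pi_div_two, Real.sin_add_pi_div_two,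
      Real.cos_add_pi, Real.sin_add, Real.sin_nat_mul_pi, abs_mul, abs_mul, abs_pow, abs_neg,
      neg_div, neg_div, abs_neg, abs_of_nonneg hcos0, abs_of_nonneg (by positivity), mul_zero,
      add_zero, abs_mul, hcosx, mul_one]
    gcongr

theorem abs_srwSpectral_sub_le {n : ℕ} (t x : ℕ) (hn : 4 ≤ n) :
    |srwSpectral n t x - 2 * (Real.cot (Real.pi / (2 * n)) / n) * Real.cos (Real.pi / n) ^ t *
        Real.sin (Real.pi * x / n)| ≤
      (8 / n ^ 2 * Real.cos (Real.pi / n) ^ t + 2 * n ^ 2 * Real.cos (2 * (Real.pi / n)) ^ t) *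
        |Real.sin (Real.pi * x / n)| := by
  obtain ⟨m, rfl⟩ : ∃ m, n = m + 2 := ⟨n - 2, by omega⟩
  have hn0 : (4 : ℝ) ≤ (m + 2 : ℕ) := by exact_mod_cast hn
  set n := m + 2 with hnm
  have hθ : Real.pi / n ≤ Real.pi / 4 := by gcongr
  have hθ0 : 0 < Real.pi / n := by positivity
  have hc : 0 ≤ Real.cos (Real.pi / n) :=
    Real.cos_nonneg_of_neg_pi_div_two_le_of_le (by linarith) (by linarith)
  have hc₂ : 0 ≤ Real.cos (2 * (Real.pi / n)) :=
    Real.cos_nonneg_of_neg_pi_div_two_le_of_le (by linarith) (by linarith)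
  set s := Real.sin (Real.pi * x / n) with hs
  set f : ℕ → ℝ := fun j => Real.cot ((2 * j + 1) * (Real.pi / (2 * n))) / n *
    Real.cos ((2 * j + 1) * (Real.pi / n)) ^ t * Real.sin ((2 * j + 1) * (Real.pi * x / n))
    with hf
  have hsum : srwSpectral n t x = ∑ j ∈ Finset.range m, f (j + 1) + f 0 + f (m + 1) := by
    rw [srwSpectral, hnm, Finset.sum_range_succ, Finset.sum_range_succ']
  have hfirst : f 0 = Real.cot (Real.pi / (2 * n)) / n * Real.cos (Real.pi / n) ^ t * s := by
    simp [hf, hs]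
  have hlast : f (m + 1) = Real.cot (Real.pi / (2 * n)) / n * Real.cos (Real.pi / n) ^ t * s := by
    have hk : 2 * ((m + 1 : ℕ) : ℝ) + 1 = 2 * n - 1 := by
      rw [hnm]
      push_cast
      ring
    have e₁ : (2 * (n : ℝ) - 1) * (Real.pi / (2 * n)) = Real.pi - Real.pi / (2 * n) := by
      field_simp
    have e₂ : (2 * (n : ℝ) - 1) * (Real.pi / n) = 2 * Real.pi - Real.pi / n := by
      field_simp
    have e₃ : (2 * (n : ℝ) - 1) * (Real.pi * x / n) =
        x * (2 * Real.pi) - Real.pi * x / n := by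
      field_simp
    simp only [hf, hk]
    rw [e₁, e₂, e₃, Real.cot_eq_cos_div_sin, Real.cot_eq_cos_div_sin, Real.cos_pi_sub,
      Real.sin_pi_sub, Real.cos_two_pi_sub, Real.sin_nat_mul_two_pi_sub]
    ring
  have hterm : ∀ j ∈ Finset.range m, |f (j + 1)| ≤
      (if n ≤ 2 * (j + 1) + 2 ∧ 2 * (j + 1) ≤ n then
        4 / n ^ 2 * Real.cos (Real.pi / n) ^ t * |s| else 0) +
      2 * n * Real.cos (2 * (Real.pi / n)) ^ t * |s| := by
    intro j hj
    have hj := Finset.mem_range.1 hj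
    split_ifs with h
    · exact (abs_srwSpectral_middle_term_le t (by omega) h.1 h.2).trans
        (le_add_of_nonneg_right (by positivity))
    · rw [zero_add]
      exact abs_srwSpectral_far_term_le t (by omega) (by omega) (by omega)
  have hcard : ((Finset.range m).filter fun j => n ≤ 2 * (j + 1) + 2 ∧ 2 * (j + 1) ≤ n).card ≤ 2 := by
    have hsub : ((Finset.range m).filter fun j => n ≤ 2 * (j + 1) + 2 ∧ 2 * (j + 1) ≤ n) ⊆
        Finset.Icc ((m - 1) / 2) (m / 2) := by
      intro j hj
      simp only [Finset.mem_filter, Finset.mem_Icc] at hj ⊢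
      omega
    refine (Finset.card_le_card hsub).trans ?_
    rw [Nat.card_Icc]
    omega
  have hdiff : srwSpectral n t x - 2 * (Real.cot (Real.pi / (2 * n)) / n) *
      Real.cos (Real.pi / n) ^ t * s = ∑ j ∈ Finset.range m, f (j + 1) := by
    rw [hsum, hfirst, hlast]
    ring
  rw [hdiff]
  refine (Finset.abs_sum_le_sum_abs _ _).trans ((Finset.sum_le_sum hterm).trans ?_)
  rw [Finset.sum_add_distrib, ← Finset.sum_filter, Finset.sum_const, Finset.sum_const,
    Finset.card_range, nsmul_eq_mul, nsmul_eq_mul]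
  have hcard' : (((Finset.range m).filter
      fun j => n ≤ 2 * (j + 1) + 2 ∧ 2 * (j + 1) ≤ n).card : ℝ) ≤ 2 := by exact_mod_cast hcard
  have hmn : (m : ℝ) ≤ n := by exact_mod_cast (by omega : m ≤ n)
  calc _ ≤ 2 * (4 / n ^ 2 * Real.cos (Real.pi / n) ^ t * |s|) +
        n * (2 * n * Real.cos (2 * (Real.pi / n)) ^ t * |s|) := by gcongr
    _ = _ := by ring

theorem eventually_cos_two_mul_pow_le {t : ℕ → ℕ}
    (ht : 4 / Real.pi ^ 2
      ≤ Filter.liminf (fun n : ℕ => (t n : ℝ) / ((n : ℝ) ^ 2 * Real.log n)) atTop) :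
    ∀ᶠ n : ℕ in atTop, Real.cos (2 * (Real.pi / n)) ^ t n ≤
      Real.cos (Real.pi / n) ^ t n / n ^ 4 := by
  rw [Filter.liminf_eq] at ht
  have hlt : 3 / Real.pi ^ 2 < 4 / Real.pi ^ 2 := by gcongr; norm_num
  have hne : {a : ℝ | ∀ᶠ n : ℕ in atTop, a ≤ (t n : ℝ) / ((n : ℝ) ^ 2 * Real.log n)}.Nonempty :=
    ⟨0, Filter.Eventually.of_forall fun n => by
      have := Real.log_natCast_nonneg n
      positivity⟩
  obtain ⟨a, ha, hca⟩ := exists_lt_of_lt_csSup hne (hlt.trans_le ht)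
  filter_upwards [ha, eventually_ge_atTop 8] with n hna hn
  have hn' : (8 : ℝ) ≤ n := by exact_mod_cast hn
  have hn0 : (0 : ℝ) < n := by linarith
  have hlog : 0 < Real.log n := Real.log_pos (by linarith)
  have htn : 3 / Real.pi ^ 2 * ((n : ℝ) ^ 2 * Real.log n) ≤ t n :=
    (le_div_iff₀ (by positivity)).1 (hca.le.trans hna)
  have hθ0 : 0 < Real.pi / n := by positivity
  have hθ : Real.pi / n ≤ 1 / 2 := by
    rw [div_le_iff₀ hn0]
    linarith [Real.pi_le_four]
  have hbound := cos_two_mul_le_cos_mul_exp (θ := Real.pi / n)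
    (by rw [abs_of_pos (by positivity)]; linarith)
  have hcos : 0 ≤ Real.cos (2 * (Real.pi / n)) :=
    Real.cos_nonneg_of_neg_pi_div_two_le_of_le (by linarith [Real.pi_pos])
      (by linarith [Real.pi_gt_three])
  have hcos₁ : 0 ≤ Real.cos (Real.pi / n) :=
    Real.cos_nonneg_of_neg_pi_div_two_le_of_le (by linarith [Real.pi_pos])
      (by linarith [Real.pi_gt_three])
  calc Real.cos (2 * (Real.pi / n)) ^ t n
      ≤ (Real.cos (Real.pi / n) * Real.exp (-(4 / 3) * (Real.pi / n) ^ 2)) ^ t n := by gcongr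
    _ = Real.cos (Real.pi / n) ^ t n * Real.exp (t n * (-(4 / 3) * (Real.pi / n) ^ 2)) := by
      rw [mul_pow, ← Real.exp_nat_mul]
    _ ≤ Real.cos (Real.pi / n) ^ t n * Real.exp (-(4 * Real.log n)) := by
      gcongr
      calc (t n : ℝ) * (-(4 / 3) * (Real.pi / n) ^ 2)
          = -((4 / 3) * (Real.pi / n) ^ 2 * t n) := by ring
        _ ≤ -((4 / 3) * (Real.pi / n) ^ 2 * (3 / Real.pi ^ 2 * ((n : ℝ) ^ 2 * Real.log n))) := by
          gcongr
        _ = -(4 * Real.log n) := by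
          field_simp
    _ = Real.cos (Real.pi / n) ^ t n / n ^ 4 := by
      rw [Real.exp_neg, show (4 : ℝ) = (4 : ℕ) by norm_num, Real.exp_nat_mul, Real.exp_log hn0,
        ← div_eq_mul_inv]

/-- if `t = t(n)` satisfies
`liminf t/(n² ln n) ≥ 4/π²`, then, uniformly in `1 ≤ x ≤ n - 1`,
`h_n(x, t) = (1 + O(n⁻²)) (4/π) cos^t(π/n) sin(πx/n)`, where `h_n(x,t)` is the
probability that the simple random walk started at `x` does not hit `{0, n}`
up to time `t`. -/
theorem srw_not_hitting_probability_asymptotics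
    {Ω : Type*} [MeasurableSpace Ω] (P : ℤ → Measure Ω) (S : ℕ → Ω → ℤ)
    (hS : IsSRW P S) (t : ℕ → ℕ)
    (ht : 4 / Real.pi ^ 2
      ≤ Filter.liminf (fun n : ℕ => (t n : ℝ) / ((n : ℝ) ^ 2 * Real.log n)) atTop) :
    ∃ C > (0 : ℝ), ∃ n₀ : ℕ, ∀ n ≥ n₀, ∀ x : ℕ, 1 ≤ x → x ≤ n - 1 →
      |((P (x : ℤ)) {ω | ∀ s ≤ t n, S s ω ∉ ({0, (n : ℤ)} : Set ℤ)}).toReal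
          / ((4 / Real.pi) * Real.cos (Real.pi / n) ^ (t n)
              * Real.sin (Real.pi * (x : ℝ) / n)) - 1|
        ≤ C / (n : ℝ) ^ 2 := by
  classical
  obtain ⟨n₁, hn₁⟩ := eventually_atTop.1 (eventually_cos_two_mul_pow_le ht)
  refine ⟨12, by norm_num, max n₁ 4, fun n hn x hx₁ hxn => ?_⟩
  have hn4 : 4 ≤ n := (le_max_right _ _).trans hn
  have hdecay := hn₁ n ((le_max_left _ _).trans hn)
  have hspec := srwAvoid_eq_ofReal_srwSpectral (n := n) (by omega) (t n) x (by omega)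
  rw [hS.measure_avoid, hspec.2, ENNReal.toReal_ofReal hspec.1]
  have hn' : (4 : ℝ) ≤ n := by exact_mod_cast hn4
  have hn0 : (0 : ℝ) < n := by linarith
  have hθ : Real.pi / n ≤ Real.pi / 4 := by gcongr
  have hθ0 : 0 < Real.pi / n := by positivity
  have hc : 0 < Real.cos (Real.pi / n) :=
    Real.cos_pos_of_mem_Ioo ⟨by linarith, by linarith⟩
  have hs : 0 < Real.sin (Real.pi * x / n) := by
    have hx0 : (0 : ℝ) < x := by exact_mod_cast hx₁
    have hxn' : (x : ℝ) < n := by exact_mod_cast (by omega : x < n)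
    refine Real.sin_pos_of_pos_of_lt_pi (by positivity) ?_
    rw [div_lt_iff₀ hn0]
    exact mul_lt_mul_of_pos_left hxn' Real.pi_pos
  have hmain := abs_srwSpectral_sub_le (t n) x hn4
  have hφ : Real.pi / (2 * n) = Real.pi / n / 2 := by ring
  have hcot := abs_mul_cot_sub_one_le (φ := Real.pi / (2 * n)) (by positivity)
    (by linarith)
  rw [abs_of_pos hs] at hmain
  set c := Real.cos (Real.pi / n) ^ t n with hcdef
  set s := Real.sin (Real.pi * x / n)
  have hcpos : 0 < c := pow_pos hc _
  set κ := Real.cot (Real.pi / (2 * n))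
  have hM : 0 < 4 / Real.pi * c * s := by positivity
  have hsplit : srwSpectral n (t n) x / (4 / Real.pi * c * s) - 1 =
      (srwSpectral n (t n) x - 2 * (κ / n) * c * s) / (4 / Real.pi * c * s) +
        (Real.pi / (2 * n) * κ - 1) := by
    field_simp
    ring
  have hfirst : |(srwSpectral n (t n) x - 2 * (κ / n) * c * s) / (4 / Real.pi * c * s)| ≤
      10 / n ^ 2 := by
    rw [abs_div, abs_of_pos hM, div_le_iff₀ hM]
    calc _ ≤ (8 / n ^ 2 * c + 2 * n ^ 2 * Real.cos (2 * (Real.pi / n)) ^ t n) * s := hmain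
      _ ≤ (8 / n ^ 2 * c + 2 * n ^ 2 * (c / n ^ 4)) * s := by gcongr
      _ = 10 / n ^ 2 * (1 * c * s) := by
        field_simp
        ring
      _ ≤ 10 / n ^ 2 * (4 / Real.pi * c * s) := by
        gcongr
        rw [one_le_div Real.pi_pos]
        exact Real.pi_le_four
  have hsecond : (Real.pi / (2 * n)) ^ 2 / 2 ≤ 2 / n ^ 2 := by
    rw [div_pow, div_div, div_le_div_iff₀ (by positivity) (by positivity)]
    have hπ : Real.pi ^ 2 ≤ 16 := by nlinarith [Real.pi_le_four, Real.pi_pos]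
    linarith [mul_le_mul_of_nonneg_right hπ (sq_nonneg (n : ℝ))]
  rw [hsplit]
  calc _ ≤ 10 / (n : ℝ) ^ 2 + 2 / n ^ 2 :=
        (abs_add_le _ _).trans (add_le_add hfirst (hcot.trans hsecond))
    _ = 12 / (n : ℝ) ^ 2 := by ring
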